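/- (Comparison principle with variable curvature bounds) Let Ω ⊆ ℂ be a bounded open set and let K₀, k_a, k_b : Ω → ℝ be functions with −k_a ≥ −k_b > 0 on Ω (i.e. k_a ≤ k_b < 0). Suppose u_a, u_b are continuous on the closure of Ω, C² on Ω, and satisfy Δu_a + k_a·e^{2u_a} = K₀ and Δu_b + k_b·e^{2u_b} = K₀ on Ω. If u_a ≤ u_b on the boundary ∂Ω, then u_a ≤ u_b on all of Ω. -/

import Mathlib

/-- The Euclidean Laplacian of `u : ℂ → ℝ` on an (open) set `s`, computed via second
derivatives within `s` in the directions `1` and `I`. -/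
noncomputable def laplacianOn (u : ℂ → ℝ) (s : Set ℂ) (z : ℂ) : ℝ :=
  iteratedFDerivWithin ℝ 2 u s z ![1, 1] +
    iteratedFDerivWithin ℝ 2 u s z ![Complex.I, Complex.I]

/-- At a local maximum, the second derivative of a real function of one variable is nonpositive. -/
theorem IsLocalMax.deriv_deriv_nonpos {g : ℝ → ℝ} {x : ℝ} (h : IsLocalMax g x)
    (hc : ContinuousAt g x) : deriv (deriv g) x ≤ 0 := by
  by_contra! hpos
  have hmin := isLocalMin_of_deriv_deriv_pos hpos h.deriv_eq_zero hc
  have heq : g =ᶠ[nhds x] fun _ => g x := by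
    filter_upwards [h, hmin] with y h₁ h₂ using le_antisymm h₁ h₂
  have h0 : deriv (deriv g) x = 0 := by
    rw [heq.deriv.deriv_eq]
    simp
  exact hpos.ne' h0

/-- At a local maximum, the Hessian is nonpositive in every direction. -/
theorem IsLocalMax.iteratedFDeriv_two_nonpos {E : Type*} [NormedAddCommGroup E] [NormedSpace ℝ E]
    {f : E → ℝ} {z : E} (h : IsLocalMax f z) (hf : ContDiffAt ℝ 2 f z) (v : E) :
    iteratedFDeriv ℝ 2 f z ![v, v] ≤ 0 := by
  have hγ (t : ℝ) : HasDerivAt (fun t : ℝ => z + t • v) v t := by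
    simpa using ((hasDerivAt_id t).smul_const v).const_add z
  have hγ0 : Filter.Tendsto (fun t : ℝ => z + t • v) (nhds 0) (nhds z) := by
    simpa using (hγ 0).continuousAt.tendsto
  have hd : deriv (fun t : ℝ => f (z + t • v)) =ᶠ[nhds 0]
      fun t => fderiv ℝ f (z + t • v) v := by
    filter_upwards [hγ0.eventually (hf.eventually (by simp))] with t ht
    exact ((ht.differentiableAt (by simp)).hasFDerivAt.comp_hasDerivAt t (hγ t)).deriv
  have hf' : DifferentiableAt ℝ (fderiv ℝ f) (z + (0 : ℝ) • v) := by
    simpa using (hf.fderiv_right (m := 1) (by norm_num)).differentiableAt (by simp)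
  have hdd : deriv (deriv fun t : ℝ => f (z + t • v)) 0 = fderiv ℝ (fderiv ℝ f) z v v := by
    rw [hd.deriv_eq]
    have h₁ : HasDerivAt (fun t : ℝ => fderiv ℝ f (z + t • v))
        (fderiv ℝ (fderiv ℝ f) (z + (0 : ℝ) • v) v) 0 :=
      hf'.hasFDerivAt.comp_hasDerivAt 0 (hγ 0)
    have h₂ := (h₁.clm_apply (hasDerivAt_const 0 v)).deriv
    rw [h₂]
    simp
  have hmax : IsLocalMax (fun t : ℝ => f (z + t • v)) 0 := by
    simpa [IsLocalMax, IsMaxFilter] using hγ0.eventually h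
  have hcont : ContinuousAt (fun t : ℝ => f (z + t • v)) 0 :=
    ContinuousAt.comp (by simpa using hf.continuousAt) (hγ 0).continuousAt
  simpa [iteratedFDeriv_two_apply, hdd] using hmax.deriv_deriv_nonpos hcont

theorem IsLocalMax.laplacianOn_nonpos {u : ℂ → ℝ} {s : Set ℂ} {z : ℂ} (h : IsLocalMax u z)
    (hs : IsOpen s) (hz : z ∈ s) (hu : ContDiffAt ℝ 2 u z) : laplacianOn u s z ≤ 0 := by
  rw [laplacianOn, iteratedFDerivWithin_of_isOpen 2 hs hz]
  exact add_nonpos (h.iteratedFDeriv_two_nonpos hu 1) (h.iteratedFDeriv_two_nonpos hu Complex.I)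

theorem laplacianOn_sub {u v : ℂ → ℝ} {s : Set ℂ} {z : ℂ} (hs : IsOpen s) (hz : z ∈ s)
    (hu : ContDiffWithinAt ℝ 2 u s z) (hv : ContDiffWithinAt ℝ 2 v s z) :
    laplacianOn (u - v) s z = laplacianOn u s z - laplacianOn v s z := by
  simp only [laplacianOn, iteratedFDerivWithin_sub_apply hu hv hs.uniqueDiffOn hz,
    sub_apply]
  ring

/-- **Comparison principle with variable curvature bounds.** Let `Ω ⊆ ℂ` be bounded
open, and `k_a ≤ k_b < 0` on `Ω`. If `u_a, u_b` are continuous on the closure of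
`Ω`, C² on `Ω`, solve `Δu_a + k_a·e^{2u_a} = K₀` and `Δu_b + k_b·e^{2u_b} = K₀` on
`Ω`, and `u_a ≤ u_b` on `∂Ω`, then `u_a ≤ u_b` on `Ω`. -/
theorem curvature_equation_comparison_variable
    (Ω : Set ℂ) (hbdd : Bornology.IsBounded Ω) (hopen : IsOpen Ω)
    (K₀ ka kb : ℂ → ℝ)
    (hk : ∀ z ∈ Ω, ka z ≤ kb z ∧ kb z < 0)
    (ua ub : ℂ → ℝ)
    (huacont : ContinuousOn ua (closure Ω)) (hubcont : ContinuousOn ub (closure Ω))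
    (huaC2 : ContDiffOn ℝ 2 ua Ω) (hubC2 : ContDiffOn ℝ 2 ub Ω)
    (hequa : ∀ z ∈ Ω, laplacianOn ua Ω z + ka z * Real.exp (2 * ua z) = K₀ z)
    (hequb : ∀ z ∈ Ω, laplacianOn ub Ω z + kb z * Real.exp (2 * ub z) = K₀ z)
    (hboundary : ∀ z ∈ frontier Ω, ua z ≤ ub z) :
    ∀ z ∈ Ω, ua z ≤ ub z := by
  have hw2 : ContDiffOn ℝ 2 (ua - ub) Ω := huaC2.sub hubC2
  have hwc : ContinuousOn (ua - ub) (closure Ω) := huacont.sub hubcont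
  intro z₀ hz₀
  by_contra! hlt
  obtain ⟨z, hz, hmax⟩ :=
    hbdd.isCompact_closure.exists_isMaxOn ⟨z₀, subset_closure hz₀⟩ hwc
  have hpos : ub z < ua z := by
    have h := hmax (subset_closure hz₀)
    simp only [Set.mem_ofPred_eq, Pi.sub_apply] at h
    linarith
  have hzΩ : z ∈ Ω := by
    by_contra hn
    exact (hboundary z ⟨hz, by rwa [hopen.interior_eq]⟩).not_gt hpos
  have hloc : IsLocalMax (ua - ub) z :=
    (hmax.on_subset subset_closure).isLocalMax (hopen.mem_nhds hzΩ)
  have hle := hloc.laplacianOn_nonpos hopen hzΩ (hw2.contDiffAt (hopen.mem_nhds hzΩ))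
  rw [laplacianOn_sub hopen hzΩ (huaC2 z hzΩ) (hubC2 z hzΩ)] at hle
  have ha := hequa z hzΩ
  have hb := hequb z hzΩ
  obtain ⟨hab, hneg⟩ := hk z hzΩ
  have hexp : Real.exp (2 * ub z) < Real.exp (2 * ua z) := Real.exp_lt_exp.2 (by linarith)
  have h1 := mul_le_mul_of_nonneg_right hab (Real.exp_pos (2 * ua z)).le
  have h2 := mul_lt_mul_of_neg_left hexp hneg
  linarith
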